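/- Let 1 ≤ j ≤ k−1 be integers and c > 0 a sufficiently large constant (depending on k and j). Suppose p1 = p1(n), p2 = p2(n) satisfy p1·p2 = 1/(c·n^{2k−2j−1}·log n) and j(k−j)!·log n/(2n^{k−j}) ≤ p1, p2 ≤ 2/(j(k−j)!·c·n^{k−j−1}·(log n)²), and let H ∼ H_k(n,p1,p2). Then the expected number of edge-minimal traversable triples contained in H whose size ℓ satisfies log n ≤ ℓ ≤ binom(k,j)·log n tends to 0 as n → ∞; that is, Σ_{ℓ,r,b} Σ_{T ∈ T_{ℓ,r,b}} P(T ⊆ H) = o(1), where the outer sum is over integers ℓ, r, b with log n ≤ ℓ ≤ binom(k,j)·log n and 0 ≤ r, b ≤ ℓ−1, and for T = (J0,F1,F2) the event T ⊆ H means that every edge of F1 is a red edge of H and every edge of F2 is a blue edge of H (so P(T ⊆ H) = p1^{|F1|}·p2^{|F2|}). -/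

import Mathlib

open Finset Filter

/-- A subfamily `Jstar ⊆ Jfam` of `j`-sets is `Jfam`-traversable in the `k`-graph `(V, E)`:
for any two distinct `A, B ∈ Jstar` there is a sequence of edges `e_0, …, e_m ∈ E` with
`A ⊆ e_0`, `B ⊆ e_m`, such that the intersection of any two consecutive edges contains some
`j`-set belonging to `Jfam`.  (Singletons are trivially traversable.) -/
def TravIn {V : Type*} [DecidableEq V] (Jfam E Jstar : Finset (Finset V)) : Prop :=
  ∀ A ∈ Jstar, ∀ B ∈ Jstar, A ≠ B →
    ∃ (m : ℕ) (es : Fin (m + 1) → Finset V),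
      (∀ i, es i ∈ E) ∧ A ⊆ es 0 ∧ B ⊆ es (Fin.last m) ∧
      ∀ i : Fin m, ∃ I ∈ Jfam, I ⊆ es i.castSucc ∧ I ⊆ es i.succ

/-- The family `Jfam` is traversable in `(V, E)` if it is `Jfam`-traversable. -/
def Trav {V : Type*} [DecidableEq V] (Jfam E : Finset (Finset V)) : Prop :=
  TravIn Jfam E Jfam

/-- A triple `(J0, E1, E2)` is traversable if `J0` is traversable in both the red `k`-graph
`(V, E1)` and the blue `k`-graph `(V, E2)`. -/
def TravTriple {V : Type*} [DecidableEq V] (J0 E1 E2 : Finset (Finset V)) : Prop :=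
  Trav J0 E1 ∧ Trav J0 E2

/-- A triple `(J0, E1, E2)` is an edge-minimal traversable triple if it is traversable and
removing any edge from `E1` or from `E2` destroys traversability. -/
def EdgeMinTravTriple {V : Type*} [DecidableEq V] (J0 E1 E2 : Finset (Finset V)) : Prop :=
  TravTriple J0 E1 E2 ∧
  (∀ e ∈ E1, ¬ Trav J0 (E1.erase e)) ∧
  (∀ e ∈ E2, ¬ Trav J0 (E2.erase e))

open scoped Classical in
/-- The expected number of edge-minimal traversable triples `T = (J0, F1, F2)` contained in
`H ~ H_k(n, p1, p2)` whose size `ℓ = |J0|` satisfies `log n ≤ ℓ ≤ binom(k,j)·log n`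
(and `0 ≤ |F1|, |F2| ≤ ℓ−1`): the sum over all such triples of
`P(T ⊆ H) = p1^{|F1|}·p2^{|F2|}`. -/
noncomputable def expMinTravTriples (n k j : ℕ) (p1 p2 : ℝ) : ℝ :=
  ∑ J0 ∈ ((Finset.univ : Finset (Fin n)).powersetCard j).powerset,
    ∑ F1 ∈ ((Finset.univ : Finset (Fin n)).powersetCard k).powerset,
      ∑ F2 ∈ ((Finset.univ : Finset (Fin n)).powersetCard k).powerset,
        if EdgeMinTravTriple J0 F1 F2 ∧
            Real.log n ≤ (J0.card : ℝ) ∧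
            (J0.card : ℝ) ≤ (k.choose j : ℝ) * Real.log n ∧
            F1.card ≤ J0.card - 1 ∧ F2.card ≤ J0.card - 1
        then p1 ^ F1.card * p2 ^ F2.card
        else 0

section aux

theorem perc_aux {α : Type*} [Fintype α] [DecidableEq α] (R : α → α → Prop) [DecidableRel R]
    (D : ℕ) (hD : ∀ a, (univ.filter (R a)).card ≤ D) (v : α) (p q : ℝ) (hp : 0 ≤ p) (hq : 0 ≤ q)
    (hpq : p + q = 1) (SS : Finset (Finset α)) (hv : ∀ S ∈ SS, v ∈ S)
    (hS : ∀ S ∈ SS, ∀ x ∈ S, Relation.ReflTransGen (fun a b => b ∈ S ∧ R a b) v x) :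
    ∑ S ∈ SS, (p * q ^ D) ^ S.card ≤ 1 := by
  classical
  set B : Finset α → Finset α := fun S => S ∪ S.biUnion (fun a => univ.filter (R a)) with hB
  have hq1 : q ≤ 1 := by linarith
  set w : Finset α → ℝ := fun W => p ^ W.card * q ^ ((univ : Finset α).card - W.card) with hw
  have hw0 : ∀ W, 0 ≤ w W := fun W => by positivity
  have htot : ∑ W ∈ (univ : Finset α).powerset, w W = 1 := by
    rw [hw, Finset.sum_pow_mul_eq_add_pow, hpq, one_pow]
  have hsub : ∀ S S' U U' : Finset α, S ∈ SS → S' ∈ SS → U' ⊆ univ \ B S' →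
      S ∪ U = S' ∪ U' → S ⊆ S' := by
    intro S S' U U' h h' hU' he x hx
    have := hS S h x hx
    induction this with
    | refl => exact hv S' h'
    | tail _ hbc ih =>
      rename_i b c hab
      have hb : b ∈ S' := by
        rcases Relation.ReflTransGen.cases_tail hab with h1 | ⟨d, _, h1⟩
        · subst h1; exact hv S' h'
        · exact ih h1.1
      have hcW : c ∈ S' ∪ U' := by rw [← he]; exact mem_union_left _ hbc.1
      have hcB : c ∈ B S' := by
        simp only [hB, mem_union, mem_biUnion, mem_filter, mem_univ, true_and]
        exact Or.inr ⟨b, hb, hbc.2⟩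
      rcases mem_union.1 hcW with h1 | h1
      · exact h1
      · exact absurd hcB (mem_sdiff.1 (hU' h1)).2
  have key : ∀ S ∈ SS, (p * q ^ D) ^ S.card ≤ ∑ U ∈ (univ \ B S).powerset, w (S ∪ U) := by
    intro S _
    have hSB : S ⊆ B S := subset_union_left
    have hBc : (B S).card ≤ S.card + D * S.card := by
      refine (card_union_le _ _).trans (Nat.add_le_add_left ?_ _)
      rw [mul_comm]
      exact card_biUnion_le_card_mul _ _ _ (fun a _ => hD a)
    have h1 : ∀ U ∈ (univ \ B S).powerset, w (S ∪ U) =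
        (p ^ S.card * q ^ ((B S).card - S.card)) *
          (p ^ U.card * q ^ ((univ \ B S).card - U.card)) := by
      intro U hU
      rw [mem_powerset] at hU
      have hd : Disjoint S U := by
        rw [Finset.disjoint_left]
        intro x hx hxU
        exact (mem_sdiff.1 (hU hxU)).2 (hSB hx)
      have hc1 := card_le_card hU
      have hc2 := card_sdiff_of_subset (subset_univ (B S))
      have hc3 := card_le_card (subset_univ (B S))
      have hc4 := card_le_card hSB
      simp only [hw]
      rw [card_union_of_disjoint hd]
      have : (univ : Finset α).card - (S.card + U.card) =
        ((B S).card - S.card) + ((univ \ B S).card - U.card) := by omega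
      rw [this, pow_add, pow_add]; ring
    rw [sum_congr rfl h1, ← mul_sum, Finset.sum_pow_mul_eq_add_pow, hpq, one_pow, mul_one,
      mul_pow, ← pow_mul]
    refine mul_le_mul_of_nonneg_left ?_ (by positivity)
    exact pow_le_pow_of_le_one hq hq1 (by omega)
  refine (sum_le_sum key).trans ?_
  rw [← htot, Finset.sum_sigma' SS (fun S => (univ \ B S).powerset) (fun S U => w (S ∪ U))]
  have hinj : Set.InjOn (fun x : (_ : Finset α) × Finset α => x.1 ∪ x.2)
      (SS.sigma (fun S => (univ \ B S).powerset) : Finset _) := by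
    rintro ⟨S, U⟩ h ⟨S', U'⟩ h' he
    rw [mem_coe, mem_sigma, mem_powerset] at h h'
    change S ∪ U = S' ∪ U' at he
    change S ∈ SS ∧ U ⊆ univ \ B S at h
    change S' ∈ SS ∧ U' ⊆ univ \ B S' at h'
    have e1 : S = S' := Subset.antisymm (hsub S S' U U' h.1 h'.1 h'.2 he)
      (hsub S' S U' U h'.1 h.1 h.2 he.symm)
    subst e1
    have hSB : S ⊆ B S := subset_union_left
    have hd : ∀ U : Finset α, U ⊆ univ \ B S → U = (S ∪ U) \ S := by
      intro U hU
      ext x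
      have h1 : x ∈ U → x ∉ B S := fun h => (mem_sdiff.1 (hU h)).2
      have h2 : x ∈ S → x ∈ B S := fun h => hSB h
      constructor
      · intro hx
        exact Finset.mem_sdiff.2 ⟨Finset.mem_union_right _ hx, fun hs => h1 hx (h2 hs)⟩
      · intro hx
        have h3 := Finset.mem_sdiff.1 hx
        exact (Finset.mem_union.1 h3.1).resolve_left h3.2
    have : U = U' := by rw [hd U h.2, hd U' h'.2, he]
    subst this; rfl
  rw [← Finset.sum_image (f := w) (g := fun x : (_ : Finset α) × Finset α => x.1 ∪ x.2) hinj]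
  exact sum_le_sum_of_subset_of_nonneg (fun W _ => by simp) (fun W _ _ => hw0 W)

def TStep {V : Type*} (J E : Finset (Finset V)) (A B : Finset V) : Prop :=
  A ∈ J ∧ B ∈ J ∧ ∃ e ∈ E, A ⊆ e ∧ B ⊆ e

theorem tstep_of_path {V : Type*} [DecidableEq V] (J E : Finset (Finset V)) (B : Finset V)
    (hB : B ∈ J) (m : ℕ) :
    ∀ A ∈ J, ∀ es : Fin (m + 1) → Finset V, (∀ i, es i ∈ E) → A ⊆ es 0 → B ⊆ es (Fin.last m) →
      (∀ i : Fin m, ∃ I ∈ J, I ⊆ es i.castSucc ∧ I ⊆ es i.succ) →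
      Relation.ReflTransGen (TStep J E) A B := by
  induction m with
  | zero =>
    intro A hA es h1 h2 h3 _
    exact Relation.ReflTransGen.single ⟨hA, hB, es 0, h1 0, h2, h3⟩
  | succ m ih =>
    intro A hA es h1 h2 h3 h4
    obtain ⟨I, hI, hI1, hI2⟩ := h4 0
    refine Relation.ReflTransGen.head (b := I) ⟨hA, hI, es 0, h1 0, h2, hI1⟩ ?_
    refine ih I hI (fun i => es i.succ) (fun i => h1 _) hI2 h3 ?_
    intro i
    exact h4 i.succ

theorem path_of_tstep {V : Type*} [DecidableEq V] (J E : Finset (Finset V)) (A B : Finset V)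
    (h : Relation.ReflTransGen (TStep J E) A B) : A = B ∨
    ∃ (m : ℕ) (es : Fin (m + 1) → Finset V),
      (∀ i, es i ∈ E) ∧ A ⊆ es 0 ∧ B ⊆ es (Fin.last m) ∧
      ∀ i : Fin m, ∃ I ∈ J, I ⊆ es i.castSucc ∧ I ⊆ es i.succ := by
  induction h using Relation.ReflTransGen.head_induction_on with
  | refl => exact Or.inl rfl
  | head h1 _ ih =>
    rename_i A C _
    right
    obtain ⟨hA, hC, e, he, hAe, hCe⟩ := h1
    rcases ih with rfl | ⟨m, es, g1, g2, g3, g4⟩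
    · exact ⟨0, fun _ => e, fun _ => he, hAe, hCe, fun i => i.elim0⟩
    · refine ⟨m + 1, Fin.cons e es, ?_, by simpa using hAe, ?_, ?_⟩
      · intro i
        refine Fin.cases ?_ (fun i => ?_) i
        · simpa using he
        · simpa using g1 i
      · rw [← Fin.succ_last, Fin.cons_succ]; exact g3
      · intro i
        refine Fin.cases ?_ (fun i => ?_) i
        · exact ⟨C, hC, by simpa using hCe, by simpa using g2⟩
        · obtain ⟨I, hI, k1, k2⟩ := g4 i
          refine ⟨I, hI, ?_, by simpa using k2⟩
          rw [Fin.castSucc_succ, Fin.cons_succ]; exact k1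

theorem trav_iff {V : Type*} [DecidableEq V] (J E : Finset (Finset V)) :
    Trav J E ↔ ∀ A ∈ J, ∀ B ∈ J, A ≠ B → Relation.ReflTransGen (TStep J E) A B := by
  constructor
  · intro h A hA B hB hAB
    obtain ⟨m, es, g1, g2, g3, g4⟩ := h A hA B hB hAB
    exact tstep_of_path J E B hB m A hA es g1 g2 g3 g4
  · intro h A hA B hB hAB
    exact (path_of_tstep J E A B (h A hA B hB hAB)).resolve_left hAB

theorem trav_cover {V : Type*} [DecidableEq V] {J E : Finset (Finset V)} (h : Trav J E)
    (hJ : 2 ≤ J.card) : ∀ A ∈ J, ∃ e ∈ E, A ⊆ e := by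
  intro A hA
  obtain ⟨B, hB, hBA⟩ := Finset.exists_mem_ne (by omega : 1 < J.card) A
  obtain ⟨m, es, g1, g2, _⟩ := h A hA B hB hBA.symm
  exact ⟨es 0, g1 0, g2⟩

theorem trav_two {V : Type*} [DecidableEq V] {J E : Finset (Finset V)} (h : Trav J E)
    (e : Finset V) (he : ¬ Trav J (E.erase e)) :
    ∃ A ∈ J, ∃ B ∈ J, A ≠ B ∧ A ⊆ e ∧ B ⊆ e := by
  by_contra hcon
  push Not at hcon
  apply he
  rw [trav_iff] at h ⊢
  intro A hA B hB hAB
  have := h A hA B hB hAB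
  clear hAB hB
  induction this with
  | refl => exact Relation.ReflTransGen.refl
  | tail _ hbc ih =>
    rename_i b c _
    obtain ⟨hb, hc, f, hf, hbf, hcf⟩ := hbc
    by_cases hfe : f = e
    · subst hfe
      by_cases hbc : b = c
      · subst hbc; exact ih
      · exact absurd hcf (hcon b hb c hc hbc hbf)
    · exact ih.tail ⟨hb, hc, f, mem_erase.2 ⟨hfe, hf⟩, hbf, hcf⟩

theorem trav_conn {V : Type*} [DecidableEq V] {J E : Finset (Finset V)} (h : Trav J E)
    (j k : ℕ) (hJ : ∀ A ∈ J, A.card = j) (hk : ∀ e ∈ E, e.card = k)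
    (hE : ∀ e ∈ E, ∃ A ∈ J, A ⊆ e) (v : Finset V) (hv : v ∈ E) (x : Finset V) (hx : x ∈ E) :
    Relation.ReflTransGen
      (fun a b => b ∈ E ∧ (a.card = k ∧ b.card = k ∧ j ≤ (a ∩ b).card)) v x := by
  obtain ⟨A, hA, hAv⟩ := hE v hv
  obtain ⟨B, hB, hBx⟩ := hE x hx
  rw [trav_iff] at h
  have h2 : Relation.ReflTransGen (TStep J E) A B := by
    by_cases hAB : A = B
    · subst hAB; exact Relation.ReflTransGen.refl
    · exact h A hA B hB hAB
  have one : ∀ C ∈ J, ∀ a ∈ E, ∀ b ∈ E, C ⊆ a → C ⊆ b →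
      (b ∈ E ∧ (a.card = k ∧ b.card = k ∧ j ≤ (a ∩ b).card)) := by
    intro C hC a ha b hb hCa hCb
    refine ⟨hb, hk a ha, hk b hb, ?_⟩
    rw [← hJ C hC]
    exact card_le_card (subset_inter hCa hCb)
  clear hB
  induction h2 generalizing x with
  | refl => exact Relation.ReflTransGen.single (one A hA v hv x hx hAv hBx)
  | tail _ hbc ih =>
    obtain ⟨hb, hc, f, hf, hbf, hcf⟩ := hbc
    exact (ih f hf hbf).tail (one _ hc f hf x hx hcf hBx)

theorem card_supersets {n : ℕ} (k s : ℕ) (B : Finset (Fin n)) (hB : s ≤ B.card) :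
    ((univ : Finset (Finset (Fin n))).filter (fun e => e.card = k ∧ B ⊆ e)).card
      ≤ n ^ (k - s) := by
  obtain ⟨C, hCB, hC⟩ := Finset.exists_subset_card_eq hB
  have h1 : ((univ : Finset (Finset (Fin n))).filter (fun e => e.card = k ∧ B ⊆ e)).card ≤
      ((univ : Finset (Fin n)).powersetCard (k - s)).card := by
    refine card_le_card_of_injOn (fun e => e \ C) ?_ ?_
    · intro e he
      simp only [coe_filter, mem_univ, true_and, Set.mem_ofPred_eq] at he
      simp only [mem_coe, mem_powersetCard, subset_univ, true_and]
      rw [card_sdiff_of_subset (hCB.trans he.2), he.1, hC]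
    · intro e he e' he' h
      simp only [coe_filter, mem_univ, true_and, Set.mem_ofPred_eq] at he he'
      simp only at h
      rw [← sdiff_union_of_subset (hCB.trans he.2), h, sdiff_union_of_subset (hCB.trans he'.2)]
  refine h1.trans ?_
  rw [card_powersetCard, card_univ, Fintype.card_fin]
  exact Nat.choose_le_pow n (k - s)

theorem deg_bound {n : ℕ} (k j : ℕ) (a : Finset (Fin n)) :
    ((univ : Finset (Finset (Fin n))).filter
      (fun b => a.card = k ∧ b.card = k ∧ j ≤ (a ∩ b).card)).card
      ≤ k.choose j * n ^ (k - j) := by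
  by_cases ha : a.card = k
  · have : ((univ : Finset (Finset (Fin n))).filter
      (fun b => a.card = k ∧ b.card = k ∧ j ≤ (a ∩ b).card)) ⊆
      (a.powersetCard j).biUnion (fun C => univ.filter (fun e => e.card = k ∧ C ⊆ e)) := by
      intro b hb
      simp only [mem_filter, mem_univ, true_and] at hb
      obtain ⟨C, hC, hCj⟩ := Finset.exists_subset_card_eq hb.2.2
      simp only [mem_biUnion, mem_powersetCard, mem_filter, mem_univ, true_and]
      exact ⟨C, ⟨hC.trans inter_subset_left, hCj⟩, hb.2.1, hC.trans inter_subset_right⟩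
    refine (card_le_card this).trans ?_
    refine (card_biUnion_le_card_mul _ _ (n ^ (k - j)) ?_).trans ?_
    · intro C hC
      exact card_supersets k j C (mem_powersetCard.1 hC).2.ge
    · rw [card_powersetCard, ha]
  · simp [ha]

/-- edges containing two members of `J`. -/
def twoEdges {n : ℕ} (k : ℕ) (J : Finset (Finset (Fin n))) : Finset (Finset (Fin n)) :=
  J.offDiag.biUnion (fun x => univ.filter (fun e => e.card = k ∧ x.1 ∪ x.2 ⊆ e))

theorem card_twoEdges {n : ℕ} (k j : ℕ) (J : Finset (Finset (Fin n)))
    (hJ : ∀ A ∈ J, A.card = j) :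
    (twoEdges k J).card ≤ J.card ^ 2 * n ^ (k - j - 1) := by
  refine (card_biUnion_le_card_mul _ _ (n ^ (k - j - 1)) ?_).trans ?_
  · rintro ⟨A, B⟩ hAB
    rw [mem_offDiag] at hAB
    rw [Nat.sub_sub]
    refine card_supersets k (j + 1) _ ?_
    by_contra hlt
    push Not at hlt
    have h1 : A = A ∪ B := eq_of_subset_of_card_le subset_union_left (by
      rw [hJ A hAB.1]; exact Nat.lt_succ_iff.1 hlt)
    have h2 : B = A ∪ B := eq_of_subset_of_card_le subset_union_right (by
      rw [hJ B hAB.2.1]; exact Nat.lt_succ_iff.1 hlt)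
    exact hAB.2.2 (h1.trans h2.symm)
  · refine Nat.mul_le_mul_right _ ?_
    rw [offDiag_card, sq]; exact Nat.sub_le _ _

theorem sub_twoEdges {n : ℕ} (k : ℕ) {J E : Finset (Finset (Fin n))} (h : Trav J E)
    (hmin : ∀ e ∈ E, ¬ Trav J (E.erase e)) (hk : ∀ e ∈ E, e.card = k) : E ⊆ twoEdges k J := by
  intro e he
  obtain ⟨A, hA, B, hB, hAB, h1, h2⟩ := trav_two h e (hmin e he)
  simp only [twoEdges, mem_biUnion, mem_filter, mem_univ, true_and]
  exact ⟨(A, B), mem_offDiag.2 ⟨hA, hB, hAB⟩, hk e he, union_subset h1 h2⟩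

/-- all `j`-sets in edges of `E`. -/
def shad {n : ℕ} (j : ℕ) (E : Finset (Finset (Fin n))) : Finset (Finset (Fin n)) :=
  E.biUnion (fun e => e.powersetCard j)

theorem card_shad {n : ℕ} (k j : ℕ) (E : Finset (Finset (Fin n))) (hk : ∀ e ∈ E, e.card = k) :
    (shad j E).card ≤ k.choose j * E.card := by
  rw [mul_comm]
  refine card_biUnion_le_card_mul _ _ _ ?_
  intro e he
  rw [card_powersetCard, hk e he]

theorem sub_shad {n : ℕ} (j : ℕ) {J E : Finset (Finset (Fin n))} (h : Trav J E)
    (hJ2 : 2 ≤ J.card) (hJ : ∀ A ∈ J, A.card = j) : J ⊆ shad j E := by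
  intro A hA
  obtain ⟨e, he, hAe⟩ := trav_cover h hJ2 A hA
  exact mem_biUnion.2 ⟨e, he, mem_powersetCard.2 ⟨hAe, hJ A hA⟩⟩

end aux

section aux2

theorem F2_sum {β : Type*} (T : Finset β) (r l K N : ℕ) (L p2 : ℝ) (hp : 0 ≤ p2)
    (hT : T.card ≤ l ^ 2 * N) (hl : (l : ℝ) ≤ K * L)
    (hy : 2 * Real.exp 1 * K ^ 2 * L * N * p2 ≤ 1) :
    ∑ F ∈ T.powerset, (if r ≤ F.card ∧ l ≤ K * F.card then p2 ^ F.card else 0)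
      ≤ 2 * (2 * Real.exp 1 * K ^ 2 * L * N * p2) ^ r := by
  set y := 2 * Real.exp 1 * K ^ 2 * L * N * p2 with hydef
  have hKL : 0 ≤ (K : ℝ) * L := (Nat.cast_nonneg l).trans hl
  have hy0 : 0 ≤ y := by
    have : y = 2 * Real.exp 1 * K * (K * L) * N * p2 := by rw [hydef]; ring
    rw [this]; positivity
  rw [Finset.sum_powerset_apply_card (fun m => if r ≤ m ∧ l ≤ K * m then p2 ^ m else 0)]
  have hterm : ∀ m ∈ range (T.card + 1),
      T.card.choose m • (if r ≤ m ∧ l ≤ K * m then p2 ^ m else 0) ≤ y ^ r * (1 / 2 : ℝ) ^ m := by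
    intro m _
    split_ifs with h
    · rw [nsmul_eq_mul]
      have h1 : ((T.card.choose m : ℕ) : ℝ) ≤ (T.card : ℝ) ^ m / (m.factorial : ℝ) :=
        Nat.choose_le_pow_div m T.card
      have h2 : (T.card : ℝ) ≤ (l * K * N) * m := by
        have : T.card ≤ (l * K * N) * m := by
          calc T.card ≤ l ^ 2 * N := hT
            _ = l * l * N := by ring
            _ ≤ l * (K * m) * N := by gcongr; exact h.2
            _ = _ := by ring
        exact_mod_cast this
      have h3 : (m : ℝ) ^ m / (m.factorial : ℝ) ≤ Real.exp 1 ^ m := by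
        rw [← Real.exp_nat_mul, mul_one]
        exact Real.pow_div_factorial_le_exp (m : ℝ) (Nat.cast_nonneg m) m
      calc ((T.card.choose m : ℕ) : ℝ) * p2 ^ m
          ≤ ((T.card : ℝ) ^ m / (m.factorial : ℝ)) * p2 ^ m := by gcongr
        _ ≤ (((l * K * N) * m : ℝ) ^ m / (m.factorial : ℝ)) * p2 ^ m := by gcongr
        _ = ((l : ℝ) * K * N * p2) ^ m * ((m : ℝ) ^ m / (m.factorial : ℝ)) := by
            simp only [mul_pow]; ring
        _ ≤ ((l : ℝ) * K * N * p2) ^ m * Real.exp 1 ^ m := by gcongr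
        _ ≤ ((K * L : ℝ) * K * N * p2) ^ m * Real.exp 1 ^ m := by gcongr
        _ = y ^ m * (1 / 2 : ℝ) ^ m := by
            rw [← mul_pow, ← mul_pow, hydef]; congr 1; ring
        _ ≤ y ^ r * (1 / 2 : ℝ) ^ m := by
            gcongr ?_ * _
            exact pow_le_pow_of_le_one hy0 hy h.1
    · rw [smul_zero]; positivity
  refine (sum_le_sum hterm).trans ?_
  rw [← mul_sum, mul_comm]
  exact mul_le_mul_of_nonneg_right (sum_geometric_two_le _) (by positivity)

theorem conn_sum {n : ℕ} (k j D : ℕ) (hD : k.choose j * n ^ (k - j) ≤ D)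
    (p q : ℝ) (hp : 0 ≤ p) (hq : 0 ≤ q) (hpq : p + q = 1)
    (SS : Finset (Finset (Finset (Fin n)))) (hne : ∀ S ∈ SS, S.Nonempty)
    (hk : ∀ S ∈ SS, ∀ e ∈ S, e.card = k)
    (hS : ∀ S ∈ SS, ∀ v ∈ S, ∀ x ∈ S, Relation.ReflTransGen
      (fun a b => b ∈ S ∧ (a.card = k ∧ b.card = k ∧ j ≤ (a ∩ b).card)) v x) :
    ∑ S ∈ SS, (p * q ^ D) ^ S.card ≤ (n : ℝ) ^ k := by
  classical
  have h1 : ∑ S ∈ SS, (p * q ^ D) ^ S.card ≤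
      ∑ S ∈ SS, ∑ v ∈ (univ : Finset (Fin n)).powersetCard k,
        if v ∈ S then (p * q ^ D) ^ S.card else 0 := by
    refine sum_le_sum fun S hSS => ?_
    obtain ⟨v, hv⟩ := hne S hSS
    have := single_le_sum (s := (univ : Finset (Fin n)).powersetCard k)
      (f := fun v => if v ∈ S then (p * q ^ D) ^ S.card else 0)
      (fun i _ => by split_ifs <;> positivity)
      (mem_powersetCard.2 ⟨subset_univ v, hk S hSS v hv⟩)
    simpa [hv] using this
  refine h1.trans ?_
  rw [sum_comm]
  have h2 : ∀ v ∈ (univ : Finset (Fin n)).powersetCard k,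
      ∑ S ∈ SS, (if v ∈ S then (p * q ^ D) ^ S.card else 0) ≤ 1 := by
    intro v _
    rw [← sum_filter]
    refine perc_aux (fun a b : Finset (Fin n) => a.card = k ∧ b.card = k ∧ j ≤ (a ∩ b).card) D
      (fun a => (deg_bound k j a).trans hD) v p q hp hq hpq _ ?_ ?_
    · intro S hS'; exact (mem_filter.1 hS').2
    · intro S hS' x hx
      exact hS S (mem_filter.1 hS').1 v (mem_filter.1 hS').2 x hx
  refine (sum_le_sum h2).trans ?_
  rw [sum_const, card_powersetCard, card_univ, Fintype.card_fin, nsmul_eq_mul, mul_one]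
  exact_mod_cast Nat.choose_le_pow n k

open scoped Classical in
noncomputable def halfSum (n k j : ℕ) (p1 p2 : ℝ) : ℝ :=
  ∑ J0 ∈ ((Finset.univ : Finset (Fin n)).powersetCard j).powerset,
    ∑ F1 ∈ ((Finset.univ : Finset (Fin n)).powersetCard k).powerset,
      ∑ F2 ∈ ((Finset.univ : Finset (Fin n)).powersetCard k).powerset,
        if (EdgeMinTravTriple J0 F1 F2 ∧
            Real.log n ≤ (J0.card : ℝ) ∧
            (J0.card : ℝ) ≤ (k.choose j : ℝ) * Real.log n) ∧ F1.card ≤ F2.card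
        then p1 ^ F1.card * p2 ^ F2.card
        else 0

theorem EdgeMinTravTriple.swap {V : Type*} [DecidableEq V] {J0 F1 F2 : Finset (Finset V)}
    (h : EdgeMinTravTriple J0 F1 F2) : EdgeMinTravTriple J0 F2 F1 :=
  ⟨⟨h.1.2, h.1.1⟩, h.2.2, h.2.1⟩

theorem exp_le_half (n k j : ℕ) (p1 p2 : ℝ) (h1 : 0 ≤ p1) (h2 : 0 ≤ p2) :
    expMinTravTriples n k j p1 p2 ≤ halfSum n k j p1 p2 + halfSum n k j p2 p1 := by
  classical
  unfold expMinTravTriples halfSum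
  rw [← sum_add_distrib]
  refine sum_le_sum fun J0 _ => ?_
  rw [sum_comm (s := ((Finset.univ : Finset (Fin n)).powersetCard k).powerset)
    (t := ((Finset.univ : Finset (Fin n)).powersetCard k).powerset)
    (f := fun F1 F2 => if (EdgeMinTravTriple J0 F1 F2 ∧
            Real.log n ≤ (J0.card : ℝ) ∧
            (J0.card : ℝ) ≤ (k.choose j : ℝ) * Real.log n) ∧ F1.card ≤ F2.card
        then p2 ^ F1.card * p1 ^ F2.card else 0), ← sum_add_distrib]
  refine sum_le_sum fun F1 _ => ?_
  rw [← sum_add_distrib]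
  refine sum_le_sum fun F2 _ => ?_
  have hpos : 0 ≤ p1 ^ F1.card * p2 ^ F2.card := by positivity
  have hpos' : 0 ≤ p2 ^ F2.card * p1 ^ F1.card := by positivity
  by_cases h : EdgeMinTravTriple J0 F1 F2 ∧ Real.log n ≤ (J0.card : ℝ) ∧
            (J0.card : ℝ) ≤ (k.choose j : ℝ) * Real.log n ∧
            F1.card ≤ J0.card - 1 ∧ F2.card ≤ J0.card - 1
  · rw [if_pos h]
    rcases le_total F1.card F2.card with hle | hle
    · rw [if_pos ⟨⟨h.1, h.2.1, h.2.2.1⟩, hle⟩]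
      have : (0 : ℝ) ≤ if (EdgeMinTravTriple J0 F2 F1 ∧ Real.log n ≤ (J0.card : ℝ) ∧
            (J0.card : ℝ) ≤ (k.choose j : ℝ) * Real.log n) ∧ F2.card ≤ F1.card
        then p2 ^ F2.card * p1 ^ F1.card else 0 := by split_ifs <;> simp [hpos']
      linarith
    · rw [if_pos (c := (EdgeMinTravTriple J0 F2 F1 ∧ _) ∧ _) ⟨⟨h.1.swap, h.2.1, h.2.2.1⟩, hle⟩]
      have : (0 : ℝ) ≤ if (EdgeMinTravTriple J0 F1 F2 ∧ Real.log n ≤ (J0.card : ℝ) ∧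
            (J0.card : ℝ) ≤ (k.choose j : ℝ) * Real.log n) ∧ F1.card ≤ F2.card
        then p1 ^ F1.card * p2 ^ F2.card else 0 := by split_ifs <;> simp [hpos]
      linarith
  · rw [if_neg h]
    refine add_nonneg ?_ ?_ <;> split_ifs <;> simp [hpos, hpos']

theorem half_bound (n k j D : ℕ) (p1 p2 p q : ℝ) (h1 : 0 ≤ p1) (h2 : 0 ≤ p2)
    (hL : 2 ≤ Real.log n)
    (hp : 0 ≤ p) (hq : 0 ≤ q) (hpq : p + q = 1) (hD : k.choose j * n ^ (k - j) ≤ D)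
    (hy : 2 * Real.exp 1 * (k.choose j : ℕ) ^ 2 * Real.log n * (n ^ (k - j - 1) : ℕ) * p2 ≤ 1)
    (hz : 2 ^ (k.choose j) * p1 *
      (2 * Real.exp 1 * (k.choose j : ℕ) ^ 2 * Real.log n * (n ^ (k - j - 1) : ℕ) * p2) ≤
      Real.exp (-((k.choose j : ℕ) * (k + 1))) * (p * q ^ D)) :
    halfSum n k j p1 p2 ≤ 2 * Real.exp (-((k + 1) * Real.log n)) * (n : ℝ) ^ k := by
  classical
  set K := k.choose j with hK
  set L := Real.log n with hLdef
  set y := 2 * Real.exp 1 * (K : ℝ) ^ 2 * L * (n ^ (k - j - 1) : ℕ) * p2 with hydef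
  have hL0 : 0 ≤ L := by linarith
  have hy0 : 0 ≤ y := by positivity
  set PJ := ((Finset.univ : Finset (Fin n)).powersetCard j).powerset with hPJ
  set PK := ((Finset.univ : Finset (Fin n)).powersetCard k).powerset with hPK
  set G : Finset (Finset (Fin n)) → Prop := fun S => S.Nonempty ∧ L ≤ K * S.card ∧
    (∀ v ∈ S, ∀ x ∈ S, Relation.ReflTransGen
      (fun a b => b ∈ S ∧ (a.card = k ∧ b.card = k ∧ j ≤ (a ∩ b).card)) v x) with hG
  have hJc : ∀ J ∈ PJ, ∀ A ∈ J, A.card = j := fun J hJ A hA =>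
    (mem_powersetCard.1 (mem_powerset.1 hJ hA)).2
  have hFc : ∀ F ∈ PK, ∀ e ∈ F, e.card = k := fun J hJ A hA =>
    (mem_powersetCard.1 (mem_powerset.1 hJ hA)).2
  have step1 : halfSum n k j p1 p2 ≤
      ∑ J0 ∈ PJ, ∑ F1 ∈ PK, if G F1 ∧ J0 ⊆ shad j F1 then 2 * (p1 * y) ^ F1.card else 0 := by
    unfold halfSum
    refine sum_le_sum fun J0 hJ0 => sum_le_sum fun F1 hF1 => ?_
    -- facts from a nonzero term
    have facts : ∀ F2 ∈ PK, ((EdgeMinTravTriple J0 F1 F2 ∧ L ≤ (J0.card : ℝ) ∧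
            (J0.card : ℝ) ≤ (K : ℝ) * L) ∧ F1.card ≤ F2.card) →
        (G F1 ∧ J0 ⊆ shad j F1) ∧ F2 ⊆ twoEdges k J0 ∧ J0.card ≤ K * F2.card := by
      rintro F2 hF2 ⟨⟨hE, hl1, hl2⟩, hle⟩
      have hJ2 : 2 ≤ J0.card := by
        have : (2 : ℝ) ≤ J0.card := hL.trans hl1
        exact_mod_cast this
      have s1 := sub_shad j hE.1.1 hJ2 (hJc J0 hJ0)
      have s2 := sub_shad j hE.1.2 hJ2 (hJc J0 hJ0)
      have c1 : J0.card ≤ K * F1.card := (card_le_card s1).trans (card_shad k j F1 (hFc F1 hF1))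
      have c2 : J0.card ≤ K * F2.card := (card_le_card s2).trans (card_shad k j F2 (hFc F2 hF2))
      refine ⟨⟨⟨?_, ?_, ?_⟩, s1⟩, sub_twoEdges k hE.1.2 hE.2.2 (hFc F2 hF2), c2⟩
      · rw [nonempty_iff_ne_empty]
        rintro rfl
        rw [card_empty, mul_zero] at c1; omega
      · refine hl1.trans ?_
        exact_mod_cast c1
      · intro v hv x hx
        refine trav_conn hE.1.1 j k (hJc J0 hJ0) (hFc F1 hF1) ?_ v hv x hx
        intro e he
        obtain ⟨A, hA, _, _, _, hAe, _⟩ := trav_two hE.1.1 e (hE.2.1 e he)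
        exact ⟨A, hA, hAe⟩
    by_cases hc : (G F1 ∧ J0 ⊆ shad j F1) ∧ (J0.card : ℝ) ≤ (K : ℝ) * L
    · rw [if_pos hc.1]
      have hle := F2_sum (twoEdges k J0) F1.card J0.card K (n ^ (k - j - 1)) L p2 h2
        (card_twoEdges k j J0 (hJc J0 hJ0)) hc.2 hy
      calc _ ≤ ∑ F2 ∈ PK, (if F2 ∈ (twoEdges k J0).powerset then
              (p1 ^ F1.card * if F1.card ≤ F2.card ∧ J0.card ≤ K * F2.card
                then p2 ^ F2.card else 0) else 0) := by
            refine sum_le_sum fun F2 hF2 => ?_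
            by_cases h : (EdgeMinTravTriple J0 F1 F2 ∧ L ≤ (J0.card : ℝ) ∧
              (J0.card : ℝ) ≤ (K : ℝ) * L) ∧ F1.card ≤ F2.card
            · obtain ⟨_, f2, f3⟩ := facts F2 hF2 h
              rw [if_pos h, if_pos (mem_powerset.2 f2), if_pos ⟨h.2, f3⟩]
            · rw [if_neg h]
              split_ifs <;> positivity
        _ ≤ ∑ F2 ∈ (twoEdges k J0).powerset, (p1 ^ F1.card *
              if F1.card ≤ F2.card ∧ J0.card ≤ K * F2.card then p2 ^ F2.card else 0) := by
            rw [← sum_filter]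
            refine sum_le_sum_of_subset_of_nonneg (fun x hx => (mem_filter.1 hx).2) ?_
            intro i _ _
            split_ifs <;> positivity
        _ ≤ p1 ^ F1.card * (2 * y ^ F1.card) := by
            rw [← mul_sum]
            exact mul_le_mul_of_nonneg_left hle (by positivity)
        _ = _ := by rw [mul_pow]; ring
    · have : ∀ F2 ∈ PK, (if (EdgeMinTravTriple J0 F1 F2 ∧ L ≤ (J0.card : ℝ) ∧
              (J0.card : ℝ) ≤ (K : ℝ) * L) ∧ F1.card ≤ F2.card
              then p1 ^ F1.card * p2 ^ F2.card else 0) = 0 := by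
        intro F2 hF2
        refine if_neg fun h => hc ⟨(facts F2 hF2 h).1, h.1.2.2⟩
      rw [sum_congr rfl this, sum_const_zero]
      split_ifs <;> positivity
  refine step1.trans ?_
  rw [sum_comm]
  have hw0 : 0 ≤ p * q ^ D := by positivity
  have step2 : ∀ F1 ∈ PK, (∑ J0 ∈ PJ, if G F1 ∧ J0 ⊆ shad j F1 then 2 * (p1 * y) ^ F1.card else 0)
      ≤ if G F1 then (2 * Real.exp (-((k + 1) * L))) * (p * q ^ D) ^ F1.card else 0 := by
    intro F1 hF1
    by_cases hGF : G F1
    · simp only [hGF, true_and, if_true]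
      rw [← sum_filter, sum_const, nsmul_eq_mul]
      have c1 : (PJ.filter (fun J0 => J0 ⊆ shad j F1)).card ≤ 2 ^ (K * F1.card) := by
        calc _ ≤ (shad j F1).powerset.card :=
              card_le_card (fun x hx => mem_powerset.2 (mem_filter.1 hx).2)
          _ = 2 ^ (shad j F1).card := card_powerset _
          _ ≤ _ := Nat.pow_le_pow_right (by norm_num) (card_shad k j F1 (hFc F1 hF1))
      have c2 : ((PJ.filter (fun J0 => J0 ⊆ shad j F1)).card : ℝ) ≤ 2 ^ (K * F1.card) := by
        exact_mod_cast c1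
      calc _ ≤ (2 : ℝ) ^ (K * F1.card) * (2 * (p1 * y) ^ F1.card) := by gcongr
        _ = 2 * (2 ^ K * p1 * y) ^ F1.card := by
            rw [pow_mul, mul_assoc, mul_pow _ (p1 * y)]; ring
        _ ≤ 2 * (Real.exp (-((K : ℝ) * (k + 1))) * (p * q ^ D)) ^ F1.card := by gcongr
        _ = 2 * Real.exp (-((K : ℝ) * (k + 1))) ^ F1.card * (p * q ^ D) ^ F1.card := by
            rw [mul_pow]; ring
        _ ≤ _ := by
            gcongr
            rw [← Real.exp_nat_mul]
            apply Real.exp_le_exp.2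
            have := mul_le_mul_of_nonneg_left hGF.2.1 (by positivity : (0 : ℝ) ≤ k + 1)
            linarith
    · simp [hGF]
  refine (sum_le_sum step2).trans ?_
  rw [← sum_filter, ← mul_sum]
  refine mul_le_mul_of_nonneg_left ?_ (by positivity)
  refine conn_sum k j D hD p q hp hq hpq _ ?_ ?_ ?_
  · intro S hS; exact (mem_filter.1 hS).2.1
  · intro S hS; exact hFc S (mem_filter.1 hS).1
  · intro S hS; exact (mem_filter.1 hS).2.2.2

end aux2

section aux3

theorem final_half (k j n : ℕ) (hj : 1 ≤ j) (hjk : j ≤ k - 1) (c p1 p2 : ℝ)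
    (hc : 2 ^ (k.choose j + 2) * Real.exp 1 ^ 2 * (k.choose j : ℝ) ^ 3 *
      Real.exp ((k.choose j : ℕ) * (k + 1)) ≤ c)
    (hL : 2 ≤ Real.log n) (h1 : 0 ≤ p1) (h2 : 0 ≤ p2)
    (hpp : p1 * p2 = 1 / (c * (n : ℝ) ^ (2 * k - 2 * j - 1) * Real.log n))
    (hp2 : p2 ≤ 2 / ((j : ℝ) * ((k - j).factorial : ℝ) * c * (n : ℝ) ^ (k - j - 1) *
      (Real.log n) ^ 2)) :
    halfSum n k j p1 p2 ≤ 2 / (n : ℝ) := by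
  have hn : 0 < n := by
    rcases Nat.eq_zero_or_pos n with rfl | h
    · norm_num at hL
    · exact h
  have hnR : (0 : ℝ) < n := by exact_mod_cast hn
  have hK1 : 1 ≤ k.choose j := Nat.choose_pos (by omega)
  set K := k.choose j with hK
  have hKR : (1 : ℝ) ≤ K := by exact_mod_cast hK1
  set L := Real.log n with hLdef
  set E := Real.exp 1 with hE
  have hE1 : 1 ≤ E := Real.one_le_exp (by norm_num)
  have hX1 : 1 ≤ Real.exp ((K : ℝ) * (k + 1)) := Real.one_le_exp (by positivity)
  set X := Real.exp ((K : ℝ) * (k + 1)) with hX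
  have hc4 : 4 * E * (K : ℝ) ^ 2 ≤ c := by
    refine le_trans ?_ hc
    have e1 : (4 : ℝ) ≤ 2 ^ (K + 2) := by
      calc (4 : ℝ) = 2 ^ 2 := by norm_num
        _ ≤ 2 ^ (K + 2) := pow_le_pow_right₀ (by norm_num) (by omega)
    calc 4 * E * (K : ℝ) ^ 2 = 4 * E * (K : ℝ) ^ 2 * 1 := by ring
      _ ≤ 2 ^ (K + 2) * E ^ 2 * (K : ℝ) ^ 3 * X := by
        gcongr
        · nlinarith
        · norm_num
  have hc0 : 0 < c := lt_of_lt_of_le (by positivity) hc4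
  set D := K * n ^ (k - j) with hD
  have hD1 : 1 ≤ D := Nat.mul_pos hK1 (pow_pos hn _)
  have hDR : (1 : ℝ) ≤ D := by exact_mod_cast hD1
  have hDR' : (D : ℝ) = K * (n : ℝ) ^ (k - j) := by rw [hD]; push_cast; ring
  set N : ℝ := (n : ℝ) ^ (k - j - 1) with hN
  have hN0 : 0 < N := by positivity
  have hJ : (1 : ℝ) ≤ (j : ℝ) * ((k - j).factorial : ℝ) := by
    have : 1 ≤ j * (k - j).factorial := Nat.mul_pos hj (Nat.factorial_pos _)
    exact_mod_cast this
  have hp2' : p2 ≤ 2 / (c * N * L ^ 2) := by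
    refine hp2.trans ?_
    apply div_le_div_of_nonneg_left (by norm_num) (by positivity)
    have : 0 ≤ c * N * L ^ 2 := by positivity
    nlinarith
  have hq : Real.exp (-1) ≤ ((D : ℝ) / (D + 1)) ^ D := by
    have e1 : Real.exp (-(1 / (D : ℝ))) ≤ (D : ℝ) / (D + 1) := by
      rw [Real.exp_neg, inv_le_comm₀ (Real.exp_pos _) (by positivity)]
      have := Real.add_one_le_exp (1 / (D : ℝ))
      calc ((D : ℝ) / (D + 1))⁻¹ = 1 / (D : ℝ) + 1 := by field_simp; ring
        _ ≤ _ := this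
    calc Real.exp (-1) = Real.exp (-(1 / (D : ℝ))) ^ D := by
          rw [← Real.exp_nat_mul]; congr 1; field_simp
      _ ≤ _ := by gcongr
  have hy : 2 * E * (K : ℝ) ^ 2 * L * ((n ^ (k - j - 1) : ℕ) : ℝ) * p2 ≤ 1 := by
    push_cast
    rw [← hN]
    calc 2 * E * (K : ℝ) ^ 2 * L * N * p2 ≤ 2 * E * (K : ℝ) ^ 2 * L * N * (2 / (c * N * L ^ 2)) := by
          gcongr
      _ = (4 * E * (K : ℝ) ^ 2 / c) * (1 / L) := by field_simp; ring
      _ ≤ 1 * 1 := by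
          gcongr
          · rw [div_le_one hc0]; exact hc4
          · rw [div_le_one (by linarith)]; linarith
      _ = 1 := by ring
  have hz : 2 ^ K * p1 * (2 * E * (K : ℝ) ^ 2 * L * ((n ^ (k - j - 1) : ℕ) : ℝ) * p2) ≤
      Real.exp (-((K : ℝ) * (k + 1))) * (1 / (D + 1 : ℝ) * ((D : ℝ) / (D + 1)) ^ D) := by
    push_cast
    rw [← hN]
    have e1 : Real.exp (-((K : ℝ) * (k + 1))) * (1 / (2 * D : ℝ) * Real.exp (-1)) ≤
      Real.exp (-((K : ℝ) * (k + 1))) * (1 / (D + 1 : ℝ) * ((D : ℝ) / (D + 1)) ^ D) := by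
      gcongr
      linarith
    refine le_trans ?_ e1
    rw [Real.exp_neg, Real.exp_neg, ← hX, ← hE]
    have hexp : (n : ℝ) ^ (2 * k - 2 * j - 1) = (n : ℝ) ^ (k - j) * N := by
      rw [hN, ← pow_add]; congr 1; omega
    rw [hexp] at hpp
    have e2 : 2 ^ K * p1 * (2 * E * (K : ℝ) ^ 2 * L * N * p2) =
        2 ^ K * 2 * E * (K : ℝ) ^ 2 * L * N * (p1 * p2) := by ring
    rw [e2, hpp, hDR']
    have hM : (0 : ℝ) < (n : ℝ) ^ (k - j) := by positivity
    set M := (n : ℝ) ^ (k - j) with hMdef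
    have hL0 : 0 < L := by linarith
    have hE0 : 0 < E := by linarith
    have hX0 : 0 < X := by linarith
    have hK0 : (0 : ℝ) < K := by linarith
    have e3 : 2 ^ K * 2 * E * (K : ℝ) ^ 2 * L * N * (1 / (c * (M * N) * L)) =
        (2 ^ (K + 2) * E ^ 2 * (K : ℝ) ^ 3 * X / c) * (1 / (2 * M * K * E * X)) := by
      rw [pow_add]; field_simp
      try norm_num
    have e4 : X⁻¹ * (1 / (2 * (K * M)) * E⁻¹) = 1 * (1 / (2 * M * K * E * X)) := by
      field_simp
    rw [e3, e4]
    gcongr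
    rw [div_le_one hc0]; exact hc
  have := half_bound n k j D p1 p2 (1 / (D + 1 : ℝ)) ((D : ℝ) / (D + 1)) h1 h2 hL
    (by positivity) (by positivity) (by rw [← add_div, add_comm]; exact div_self (by positivity)) le_rfl hy hz
  refine this.trans (le_of_eq ?_)
  have : Real.exp (-(((k : ℝ) + 1) * Real.log n)) = ((n : ℝ) ^ (k + 1))⁻¹ := by
    rw [Real.exp_neg]
    congr 1
    have : ((k : ℝ) + 1) * Real.log n = ((k + 1 : ℕ) : ℝ) * Real.log n := by push_cast; ring
    rw [this, Real.exp_nat_mul, Real.exp_log hnR]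
  rw [this, pow_succ]
  field_simp

end aux3

/-- **First moment bound for the subcritical regime.** Let `1 ≤ j ≤ k−1` and let `c > 0` be
a sufficiently large constant (depending on `k` and `j`).  If
`p1·p2 = 1/(c·n^{2k−2j−1}·log n)` and
`j·(k−j)!·log n/(2n^{k−j}) ≤ p1, p2 ≤ 2/(j·(k−j)!·c·n^{k−j−1}·(log n)²)`, then the expected
number of edge-minimal traversable triples contained in `H ~ H_k(n,p1,p2)` whose size `ℓ`
satisfies `log n ≤ ℓ ≤ binom(k,j)·log n` tends to `0` as `n → ∞`. -/
theorem expected_minTravTriples_tendsto_zero (k j : ℕ) (hj : 1 ≤ j) (hjk : j ≤ k - 1) :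
    ∃ c0 : ℝ, 0 < c0 ∧
      ∀ c : ℝ, c0 ≤ c →
        ∀ p1 p2 : ℕ → ℝ,
          (∀ᶠ n : ℕ in atTop,
            p1 n * p2 n = 1 / (c * (n : ℝ) ^ (2 * k - 2 * j - 1) * Real.log n) ∧
            (j : ℝ) * ((k - j).factorial : ℝ) * Real.log n / (2 * (n : ℝ) ^ (k - j)) ≤ p1 n ∧
            p1 n ≤ 2 / ((j : ℝ) * ((k - j).factorial : ℝ) * c * (n : ℝ) ^ (k - j - 1) * (Real.log n) ^ 2) ∧
            (j : ℝ) * ((k - j).factorial : ℝ) * Real.log n / (2 * (n : ℝ) ^ (k - j)) ≤ p2 n ∧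
            p2 n ≤ 2 / ((j : ℝ) * ((k - j).factorial : ℝ) * c * (n : ℝ) ^ (k - j - 1) * (Real.log n) ^ 2)) →
          Tendsto (fun n : ℕ => expMinTravTriples n k j (p1 n) (p2 n)) atTop (nhds 0) := by
  refine ⟨2 ^ (k.choose j + 2) * Real.exp 1 ^ 2 * (k.choose j : ℝ) ^ 3 *
      Real.exp ((k.choose j : ℕ) * (k + 1)), ?_, ?_⟩
  · have : 0 < k.choose j := Nat.choose_pos (by omega)
    positivity
  intro c hc p1 p2 hev
  have hlog : ∀ᶠ n : ℕ in atTop, 2 ≤ Real.log n :=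
    (Real.tendsto_log_atTop.comp tendsto_natCast_atTop_atTop).eventually_ge_atTop 2
  have hlim : Tendsto (fun n : ℕ => (4 : ℝ) / (n : ℝ)) atTop (nhds 0) :=
    tendsto_const_div_atTop_nhds_zero_nat 4
  have hnn : ∀ᶠ n : ℕ in atTop, 0 ≤ p1 n ∧ 0 ≤ p2 n := by
    filter_upwards [hev, hlog] with n h hL
    have : 0 ≤ (j : ℝ) * ((k - j).factorial : ℝ) * Real.log n / (2 * (n : ℝ) ^ (k - j)) := by
      positivity
    exact ⟨this.trans h.2.1, this.trans h.2.2.2.1⟩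
  refine tendsto_of_tendsto_of_tendsto_of_le_of_le' tendsto_const_nhds hlim ?_ ?_
  · filter_upwards [hnn] with n h
    obtain ⟨h1, h2⟩ := h
    unfold expMinTravTriples
    refine sum_nonneg fun _ _ => sum_nonneg fun _ _ => sum_nonneg fun _ _ => ?_
    split_ifs <;> positivity
  · filter_upwards [hev, hlog, hnn] with n h hL h0
    obtain ⟨hpp, _, hu1, _, hu2⟩ := h
    have a1 := final_half k j n hj hjk c (p1 n) (p2 n) hc hL h0.1 h0.2 hpp hu2
    have a2 := final_half k j n hj hjk c (p2 n) (p1 n) hc hL h0.2 h0.1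
      (by rw [mul_comm]; exact hpp) hu1
    have a3 := exp_le_half n k j (p1 n) (p2 n) h0.1 h0.2
    have : (4 : ℝ) / n = 2 / n + 2 / n := by ring
    linarith
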